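/- Let m ≥ 2 be an integer, q complex with 0 < |q| < 1, and x_1,…,x_{m−1} complex numbers. Let K_m^{(0)}(y_1,…,y_{m−1}) = Σ_{c_1,…,c_{m−1}=0}^{∞} (−1)^{c_{m−1}} q^{c_{m−1}(c_{m−1}+1)/2} y_{m−1}^{c_{m−1}} Π_{i=1}^{m−2} q^{c_i²+c_i} y_i^{c_i} [c_{i+1} choose c_i]_q. Then Σ_{j=0}^{m−2} q^{j} · (x_{m−j}·x_{m−j+1}⋯x_{m−1}) · K_m^{(0)}( q^{−1}x_1, …, q^{−1}x_{m−2−j}, x_{m−1−j}, q·x_{m−j}, …, q·x_{m−1} ) = 1 − q^{m−1} x_1 x_2 ⋯ x_{m−1} · K_m^{(0)}(q·x_1, …, q·x_{m−1}), where the j = 0 summand is K_m^{(0)}(q^{−1}x_1,…,q^{−1}x_{m−2}, x_{m−1}) with empty coefficient product equal to 1. -/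

import Mathlib

open scoped BigOperators

/-- The Gaussian binomial coefficient `[M choose n]_q`: equal to
`(q)_M/((q)_n (q)_{M−n})` for `M ≥ n ≥ 0` and to `0` otherwise; defined via the
`q`-Pascal recursion (hence an integer polynomial in `q`). -/
def qBinom (q : ℂ) : ℕ → ℕ → ℂ
  | _, 0 => 1
  | 0, _ + 1 => 0
  | M + 1, n + 1 => q ^ (n + 1) * qBinom q M (n + 1) + qBinom q M n

/-- General term of the multivariate series `K_m^{(a)}(x_1,…,x_{m−1})` with `m = p+2`,
summed over `c : Fin (p+1) → ℕ` (`c j` is `c_{j+1}`): the last slot contributes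
`(−1)^{c_{m−1}} q^{c_{m−1}(c_{m−1}+1)/2} x_{m−1}^{c_{m−1}}`, slot `i` for `1 ≤ i ≤ a−1`
(resp. `i = a`, resp. `a+1 ≤ i ≤ m−2`) contributes `q^{c_i²} x_i^{c_i} [c_{i+1} choose c_i]_q`
(resp. `q^{c_a²} x_a^{c_a} [c_{a+1}+1 choose c_a]_q`, resp.
`q^{c_i²+c_i} x_i^{c_i} [c_{i+1} choose c_i]_q`); for `a = 0` all slots
`1 ≤ i ≤ m−2` carry `q^{c_i²+c_i} x_i^{c_i} [c_{i+1} choose c_i]_q`. -/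
noncomputable def KtermM (p a : ℕ) (q : ℂ) (x : Fin (p + 1) → ℂ)
    (c : Fin (p + 1) → ℕ) : ℂ :=
  (-1 : ℂ) ^ (c (Fin.last p)) *
    q ^ ((c (Fin.last p) * (c (Fin.last p) + 1)) / 2) *
    (x (Fin.last p)) ^ (c (Fin.last p)) *
    ∏ j : Fin p,
      q ^ ((c j.castSucc) ^ 2 + (if a ≤ (j : ℕ) then c j.castSucc else 0)) *
        (x j.castSucc) ^ (c j.castSucc) *
        qBinom q (c j.succ + (if (j : ℕ) + 1 = a then 1 else 0)) (c j.castSucc)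

theorem norm_qBinom_le {q : ℂ} (hq : ‖q‖ ≤ 1) (M n : ℕ) : ‖qBinom q M n‖ ≤ 2 ^ M := by
  induction M generalizing n with
  | zero => cases n <;> simp [qBinom]
  | succ M ih =>
    cases n with
    | zero => simpa [qBinom] using one_le_pow₀ (n := M + 1) (one_le_two (α := ℝ))
    | succ n =>
      have h1 : ‖q ^ (n + 1) * qBinom q M (n + 1)‖ ≤ 2 ^ M := by
        rw [norm_mul, norm_pow]
        exact (mul_le_of_le_one_left (norm_nonneg _) (pow_le_one₀ (norm_nonneg _) hq)).trans (ih _)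
      calc ‖qBinom q (M + 1) (n + 1)‖ ≤ 2 ^ M + 2 ^ M :=
            (norm_add_le _ _).trans (add_le_add h1 (ih n))
        _ = 2 ^ (M + 1) := by ring

theorem qBinom_zero_left_of_pos (q : ℂ) {n : ℕ} (hn : n ≠ 0) : qBinom q 0 n = 0 := by
  cases n with
  | zero => exact absurd rfl hn
  | succ n => simp [qBinom]

theorem succ_mul_succ_half (n : ℕ) : (n + 1) * (n + 2) / 2 = n * (n + 1) / 2 + (n + 1) := by
  rw [show (n + 1) * (n + 2) = n * (n + 1) + (n + 1) * 2 by ring]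
  exact Nat.add_mul_div_right _ _ two_pos

theorem summable_pow_triangular_mul_pow {r : ℝ} (hr0 : 0 ≤ r) (hr1 : r < 1) (a : ℝ) :
    Summable fun n : ℕ => r ^ (n * (n + 1) / 2) * a ^ n := by
  have hlim : Filter.Tendsto (fun n : ℕ => r ^ (n + 1) * |a|) Filter.atTop (nhds 0) := by
    have := ((tendsto_pow_atTop_nhds_zero_of_lt_one hr0 hr1).comp
      (Filter.tendsto_add_atTop_nat 1)).mul_const |a|
    simpa using this
  refine summable_of_ratio_norm_eventually_le (r := 1 / 2) (by norm_num) ?_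
  filter_upwards [hlim.eventually_le_const (show (0 : ℝ) < 1 / 2 by norm_num)] with n hn
  rw [show n + 1 + 1 = n + 2 from rfl, succ_mul_succ_half,
    show r ^ (n * (n + 1) / 2 + (n + 1)) * a ^ (n + 1) =
      (r ^ (n + 1) * a) * (r ^ (n * (n + 1) / 2) * a ^ n) by ring, norm_mul]
  refine mul_le_mul_of_nonneg_right ?_ (norm_nonneg _)
  rwa [norm_mul, Real.norm_eq_abs a, Real.norm_of_nonneg (pow_nonneg hr0 _)]

theorem summable_prod_fin {N : ℕ} {α : Type*} (h : Fin N → α → ℝ) (h0 : ∀ k a, 0 ≤ h k a)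
    (hs : ∀ k, Summable (h k)) : Summable fun c : Fin N → α => ∏ k, h k (c k) := by
  induction N with
  | zero => exact Summable.of_finite
  | succ N ih =>
    rw [← (Fin.consEquiv fun _ => α).summable_iff]
    have := (hs 0).mul_of_nonneg (ih (fun k => h k.succ) (fun k => h0 _) fun k => hs _)
      (h0 0) (fun c => Finset.prod_nonneg fun k _ => h0 _ _)
    refine this.congr fun c => ?_
    simp [Fin.prod_univ_succ, Fin.consEquiv]

theorem summable_KtermM_zero (p : ℕ) {q : ℂ} (hq : ‖q‖ < 1) (y : Fin (p + 1) → ℂ) :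
    Summable (KtermM p 0 q y) := by
  refine Summable.of_norm_bounded (summable_prod_fin
    (fun k n => ‖q‖ ^ (n * (n + 1) / 2) * (2 * ‖y k‖) ^ n) (fun k n => by positivity)
    fun k => summable_pow_triangular_mul_pow (norm_nonneg q) hq _) fun c => ?_
  have hpow : ∏ j : Fin p, (2 : ℝ) ^ c j.succ ≤ ∏ k : Fin (p + 1), 2 ^ c k := by
    rw [Fin.prod_univ_succ (fun k => (2 : ℝ) ^ c k)]
    exact le_mul_of_one_le_left (by positivity) (one_le_pow₀ one_le_two)
  have hfac : ∀ j : Fin p,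
      ‖q ^ (c j.castSucc ^ 2 + (if 0 ≤ (j : ℕ) then c j.castSucc else 0)) *
        y j.castSucc ^ c j.castSucc *
        qBinom q (c j.succ + (if (j : ℕ) + 1 = 0 then 1 else 0)) (c j.castSucc)‖ ≤
      (‖q‖ ^ (c j.castSucc * (c j.castSucc + 1) / 2) * ‖y j.castSucc‖ ^ c j.castSucc) *
        2 ^ c j.succ := by
    intro j
    simp only [norm_mul, norm_pow]
    refine mul_le_mul (mul_le_mul_of_nonneg_right ?_ (by positivity)) ?_ (norm_nonneg _)
      (by positivity)
    · refine pow_le_pow_of_le_one (norm_nonneg _) hq.le ((Nat.div_le_self _ _).trans ?_)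
      simp only [zero_le, if_true]
      exact le_of_eq (by ring)
    · simpa using norm_qBinom_le hq.le _ _
  calc ‖KtermM p 0 q y c‖
      ≤ (‖q‖ ^ (c (Fin.last p) * (c (Fin.last p) + 1) / 2) *
          ‖y (Fin.last p)‖ ^ c (Fin.last p)) *
        ∏ j : Fin p, ((‖q‖ ^ (c j.castSucc * (c j.castSucc + 1) / 2) *
          ‖y j.castSucc‖ ^ c j.castSucc) * 2 ^ c j.succ) := by
        rw [KtermM, norm_mul, norm_prod]
        refine mul_le_mul (le_of_eq ?_)
          (Finset.prod_le_prod (fun _ _ => norm_nonneg _) fun j _ => hfac j)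
          (Finset.prod_nonneg fun _ _ => norm_nonneg _) (by positivity)
        simp
    _ = (∏ k, ‖q‖ ^ (c k * (c k + 1) / 2) * ‖y k‖ ^ c k) * ∏ j : Fin p, 2 ^ c j.succ := by
        rw [Fin.prod_univ_castSucc, Finset.prod_mul_distrib]
        ring
    _ ≤ (∏ k, ‖q‖ ^ (c k * (c k + 1) / 2) * ‖y k‖ ^ c k) * ∏ k, 2 ^ c k :=
        mul_le_mul_of_nonneg_left hpow (by positivity)
    _ = ∏ k, ‖q‖ ^ (c k * (c k + 1) / 2) * (2 * ‖y k‖) ^ c k := by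
        rw [← Finset.prod_mul_distrib]
        exact Finset.prod_congr rfl fun k _ => by rw [mul_pow]; ring

/-- The Gaussian binomial coefficient `[M − 1 choose n − 1]_q`, read as `0` when `M = 0` or
`n = 0`. -/
def qBinomPred (q : ℂ) : ℕ → ℕ → ℂ
  | M + 1, n + 1 => qBinom q M n
  | _, _ => 0

theorem qBinomPred_zero_right (q : ℂ) (M : ℕ) : qBinomPred q M 0 = 0 := by
  cases M <;> rfl

theorem qBinom_eq_add_qBinomPred (q : ℂ) {M : ℕ} (hM : M ≠ 0) (n : ℕ) :
    qBinom q M n = q ^ n * qBinom q (M - 1) n + qBinomPred q M n := by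
  obtain ⟨M, rfl⟩ := Nat.exists_eq_succ_of_ne_zero hM
  cases n <;> simp [qBinom, qBinomPred]

/-- A chain of Gaussian binomials in which the factors from position `t` on are lowered in both
entries. -/
def loweredChain (q : ℂ) {p : ℕ} (c : Fin (p + 1) → ℕ) (t : ℕ) : ℂ :=
  ∏ k : Fin p, if (k : ℕ) < t then qBinom q (c k.succ) (c k.castSucc)
    else qBinomPred q (c k.succ) (c k.castSucc)

/-- A chain of Gaussian binomials in which the factors from position `t` on are lowered in both
entries and the factor before them carries the first half of the `q`-Pascal rule. -/
def pivotChain (q : ℂ) {p : ℕ} (c : Fin (p + 1) → ℕ) (t : ℕ) : ℂ :=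
  ∏ k : Fin p, if (k : ℕ) + 1 < t then qBinom q (c k.succ) (c k.castSucc)
    else if (k : ℕ) + 1 = t then
      q ^ c k.castSucc * qBinom q (c k.succ - 1) (c k.castSucc)
    else qBinomPred q (c k.succ) (c k.castSucc)

theorem loweredChain_succ (q : ℂ) {p : ℕ} {c : Fin (p + 1) → ℕ} (hc : c (Fin.last p) ≠ 0)
    {t : ℕ} (ht : t < p) :
    loweredChain q c (t + 1) = pivotChain q c (t + 1) + loweredChain q c t := by
  by_cases h0 : c (Fin.succ ⟨t, ht⟩) = 0
  · have htp : t + 1 < p := by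
      refine lt_of_le_of_ne ht fun h => hc ?_
      rwa [show Fin.last p = Fin.succ ⟨t, ht⟩ from Fin.ext h.symm]
    have h0' : c (Fin.castSucc ⟨t + 1, htp⟩) = 0 := h0
    have hz : ∀ M, qBinomPred q M (c (Fin.castSucc ⟨t + 1, htp⟩)) = 0 := fun M => by
      rw [h0', qBinomPred_zero_right]
    rw [loweredChain, pivotChain, loweredChain,
      Finset.prod_eq_zero (Finset.mem_univ ⟨t + 1, htp⟩),
      Finset.prod_eq_zero (Finset.mem_univ ⟨t + 1, htp⟩),
      Finset.prod_eq_zero (Finset.mem_univ ⟨t + 1, htp⟩), add_zero] <;> simpa using hz _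
  · have hrest : ∀ k ∈ (Finset.univ : Finset (Fin p)).erase ⟨t, ht⟩, (k : ℕ) ≠ t := fun k hk h =>
      (Finset.mem_erase.mp hk).1 (Fin.ext h)
    have hmem := Finset.mem_univ (⟨t, ht⟩ : Fin p)
    rw [loweredChain, pivotChain, loweredChain, ← Finset.mul_prod_erase _ _ hmem,
      ← Finset.mul_prod_erase _ _ hmem, ← Finset.mul_prod_erase _ _ hmem]
    set R := ∏ k ∈ (Finset.univ : Finset (Fin p)).erase ⟨t, ht⟩,
      if (k : ℕ) < t then qBinom q (c k.succ) (c k.castSucc)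
      else qBinomPred q (c k.succ) (c k.castSucc)
    have h1 : (∏ k ∈ (Finset.univ : Finset (Fin p)).erase ⟨t, ht⟩,
        if (k : ℕ) < t + 1 then qBinom q (c k.succ) (c k.castSucc)
        else qBinomPred q (c k.succ) (c k.castSucc)) = R :=
      Finset.prod_congr rfl fun k hk => by
        have := hrest k hk
        simp only [show (k : ℕ) < t + 1 ↔ (k : ℕ) < t by omega]
    have h2 : (∏ k ∈ (Finset.univ : Finset (Fin p)).erase ⟨t, ht⟩,
        if (k : ℕ) + 1 < t + 1 then qBinom q (c k.succ) (c k.castSucc)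
        else if (k : ℕ) + 1 = t + 1 then
          q ^ c k.castSucc * qBinom q (c k.succ - 1) (c k.castSucc)
        else qBinomPred q (c k.succ) (c k.castSucc)) = R :=
      Finset.prod_congr rfl fun k hk => by
        have := hrest k hk
        simp only [show (k : ℕ) + 1 < t + 1 ↔ (k : ℕ) < t by omega,
          show ¬ (k : ℕ) + 1 = t + 1 by omega, if_false]
    rw [h1, h2, ← add_mul]
    simp only [lt_add_iff_pos_right, zero_lt_one, lt_irrefl, if_true, if_false]
    rw [qBinom_eq_add_qBinomPred q h0]

theorem sum_pivotChain (q : ℂ) {p : ℕ} {c : Fin (p + 1) → ℕ} (hc : c (Fin.last p) ≠ 0)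
    {n : ℕ} (hn : n ≤ p) :
    ∑ t ∈ Finset.range (n + 1), pivotChain q c t = loweredChain q c n := by
  induction n with
  | zero => simp [pivotChain, loweredChain]
  | succ n ih =>
    rw [Finset.sum_range_succ, ih (by omega), loweredChain_succ q hc (by omega), add_comm]

theorem sum_pivotChain_eq_prod_qBinom (q : ℂ) {p : ℕ} {c : Fin (p + 1) → ℕ}
    (hc : c (Fin.last p) ≠ 0) :
    ∑ t ∈ Finset.range (p + 1), pivotChain q c t =
      ∏ k : Fin p, qBinom q (c k.succ) (c k.castSucc) := by
  rw [sum_pivotChain q hc le_rfl, loweredChain]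
  exact Finset.prod_congr rfl fun k _ => if_pos k.isLt

theorem pivotChain_eq_zero (q : ℂ) {p : ℕ} {c : Fin (p + 1) → ℕ} {t : ℕ} {k : Fin p}
    (hk : t ≤ (k : ℕ)) (hc : c k.castSucc = 0) : pivotChain q c t = 0 := by
  refine Finset.prod_eq_zero (Finset.mem_univ k) ?_
  rw [if_neg (by omega), if_neg (by omega), hc, qBinomPred_zero_right]

theorem prod_qBinom_eq_zero (q : ℂ) {p : ℕ} {c : Fin (p + 1) → ℕ} (hc : c (Fin.last p) = 0)
    (hne : c ≠ 0) : ∏ k : Fin p, qBinom q (c k.succ) (c k.castSucc) = 0 := by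
  by_contra hprod
  refine hne (funext fun i => ?_)
  induction i using Fin.reverseInduction with
  | last => exact hc
  | cast k ih =>
    by_contra hk
    refine hprod (Finset.prod_eq_zero (Finset.mem_univ k) ?_)
    rw [ih]
    exact qBinom_zero_left_of_pos q hk

/-- The monomial weight common to all the shifted series. -/
def chainWeight (q : ℂ) {p : ℕ} (x : Fin (p + 1) → ℂ) (c : Fin (p + 1) → ℕ) : ℂ :=
  (-1 : ℂ) ^ c (Fin.last p) * q ^ (c (Fin.last p) * (c (Fin.last p) + 1) / 2) *
    x (Fin.last p) ^ c (Fin.last p) *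
    ∏ k : Fin p, q ^ (c k.castSucc ^ 2) * x k.castSucc ^ c k.castSucc

/-- The argument vector whose entries at positions `≥ t` are multiplied by `q`, whose entries at
positions `< t − 1` are multiplied by `q⁻¹`, and whose entry at position `t − 1` is unchanged. -/
noncomputable def scaledArgs (q : ℂ) {p : ℕ} (x : Fin (p + 1) → ℂ) (t : ℕ) (k : Fin (p + 1)) : ℂ :=
  if (k : ℕ) + 2 ≤ t then q⁻¹ * x k else if (k : ℕ) + 1 = t then x k else q * x k

/-- The exponent vector `c` raised by one at every position `≥ t`. -/
def raiseFrom {N : ℕ} (t : ℕ) (c : Fin N → ℕ) (k : Fin N) : ℕ :=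
  c k + if t ≤ (k : ℕ) then 1 else 0

theorem raiseFrom_injective {N : ℕ} (t : ℕ) :
    Function.Injective (raiseFrom t : (Fin N → ℕ) → Fin N → ℕ) := fun _ _ h =>
  funext fun k => Nat.add_right_cancel (congrFun h k)

theorem mem_range_raiseFrom {N t : ℕ} {c : Fin N → ℕ} (h : ∀ k : Fin N, t ≤ (k : ℕ) → c k ≠ 0) :
    c ∈ Set.range (raiseFrom t : (Fin N → ℕ) → Fin N → ℕ) := by
  refine ⟨fun k => c k - if t ≤ (k : ℕ) then 1 else 0, funext fun k => ?_⟩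
  have := h k
  simp only [raiseFrom]
  split_ifs with hk
  · have := this hk
    omega
  · rfl

/-- The coefficient `q^{N−t} ∏_{k ≥ t} x_k`, written as one product. -/
theorem pow_mul_prod_ite {N t : ℕ} (ht : t ≤ N) (q : ℂ) (x : Fin N → ℂ) :
    q ^ (N - t) * ∏ k : Fin N, (if t ≤ (k : ℕ) then x k else 1) =
      ∏ k : Fin N, if t ≤ (k : ℕ) then q * x k else 1 := by
  have hq : q ^ (N - t) = ∏ k : Fin N, if t ≤ (k : ℕ) then q else 1 := by
    rw [Fin.prod_univ_eq_prod_range (fun k => if t ≤ k then q else 1) N,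
      ← Finset.prod_range_mul_prod_Ico _ ht,
      Finset.prod_congr rfl fun k hk => if_neg (not_le.mpr (Finset.mem_range.mp hk)),
      Finset.prod_congr rfl fun k hk => if_pos (Finset.mem_Ico.mp hk).1]
    simp
  rw [hq, ← Finset.prod_mul_distrib]
  exact Finset.prod_congr rfl fun k _ => by split_ifs <;> simp

theorem KtermM_scaledArgs_top {p : ℕ} {q : ℂ} (hq0 : q ≠ 0) (x : Fin (p + 1) → ℂ)
    (c : Fin (p + 1) → ℕ) :
    KtermM p 0 q (scaledArgs q x (p + 1)) c =
      chainWeight q x c * ∏ k : Fin p, qBinom q (c k.succ) (c k.castSucc) := by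
  have hlast : scaledArgs q x (p + 1) (Fin.last p) = x (Fin.last p) := by simp [scaledArgs]
  rw [KtermM, chainWeight, hlast, mul_assoc _ (∏ k : Fin p, _) (∏ k : Fin p, _),
    ← Finset.prod_mul_distrib]
  congr 1
  refine Finset.prod_congr rfl fun k _ => ?_
  have hk : scaledArgs q x (p + 1) k.castSucc = q⁻¹ * x k.castSucc :=
    if_pos (by simp only [Fin.val_castSucc]; omega)
  simp only [hk, zero_le, if_true, Nat.add_eq_zero_iff, one_ne_zero, and_false, if_false, add_zero,
    pow_add, mul_pow, inv_pow]
  field_simp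

theorem chainWeight_raiseFrom_mul_pivotChain {p : ℕ} {q : ℂ} (hq0 : q ≠ 0)
    (x : Fin (p + 1) → ℂ) {t : ℕ} (ht : t ≤ p) (c : Fin (p + 1) → ℕ) :
    -(chainWeight q x (raiseFrom t c) * pivotChain q (raiseFrom t c) t) =
      q ^ (p + 1 - t) * (∏ k : Fin (p + 1), if t ≤ (k : ℕ) then x k else 1) *
        KtermM p 0 q (scaledArgs q x t) c := by
  have hlast : scaledArgs q x t (Fin.last p) = q * x (Fin.last p) := by
    simp only [scaledArgs, Fin.val_last]
    rw [if_neg (by omega), if_neg (by omega)]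
  have hlast' : raiseFrom t c (Fin.last p) = c (Fin.last p) + 1 := by simp [raiseFrom, ht]
  have hfac : ∀ k : Fin p,
      q ^ (raiseFrom t c k.castSucc ^ 2) * x k.castSucc ^ raiseFrom t c k.castSucc *
        (if (k : ℕ) + 1 < t then
          qBinom q (raiseFrom t c k.succ) (raiseFrom t c k.castSucc)
        else if (k : ℕ) + 1 = t then
          q ^ raiseFrom t c k.castSucc *
            qBinom q (raiseFrom t c k.succ - 1) (raiseFrom t c k.castSucc)
        else qBinomPred q (raiseFrom t c k.succ) (raiseFrom t c k.castSucc)) =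
      (if t ≤ (k : ℕ) then q * x k.castSucc else 1) *
        (q ^ (c k.castSucc ^ 2 + (if 0 ≤ (k : ℕ) then c k.castSucc else 0)) *
          scaledArgs q x t k.castSucc ^ c k.castSucc *
          qBinom q (c k.succ + (if (k : ℕ) + 1 = 0 then 1 else 0)) (c k.castSucc)) := by
    intro k
    simp only [raiseFrom, scaledArgs, Fin.val_castSucc, Fin.val_succ, zero_le, if_true,
      Nat.add_eq_zero_iff, one_ne_zero, and_false, if_false, add_zero]
    rcases lt_trichotomy ((k : ℕ) + 1) t with h | h | h
    · simp only [h, show ¬ t ≤ (k : ℕ) by omega, show ¬ t ≤ (k : ℕ) + 1 by omega,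
        show (k : ℕ) + 2 ≤ t by omega, if_true, if_false, add_zero, pow_add, mul_pow, inv_pow]
      field_simp
    · simp only [h, show ¬ t ≤ (k : ℕ) by omega, show ¬ (k : ℕ) + 2 ≤ t by omega, lt_irrefl,
        le_refl, if_true, if_false, add_zero, Nat.add_sub_cancel]
      ring
    · simp only [show t ≤ (k : ℕ) by omega, show ¬ (k : ℕ) + 2 ≤ t by omega,
        show t ≤ (k : ℕ) + 1 by omega, show ¬ (k : ℕ) + 1 < t by omega,
        show ¬ (k : ℕ) + 1 = t by omega, if_true, if_false, qBinomPred]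
      ring
  rw [pow_mul_prod_ite (by omega), Fin.prod_univ_castSucc, KtermM, chainWeight, pivotChain,
    mul_assoc _ (∏ k : Fin p, _) (∏ k : Fin p, _), ← Finset.prod_mul_distrib,
    Finset.prod_congr rfl fun k _ => hfac k, Finset.prod_mul_distrib, hlast, hlast',
    show c (Fin.last p) + 1 + 1 = c (Fin.last p) + 2 from rfl, succ_mul_succ_half]
  simp only [Fin.val_last, ht, if_true, Fin.val_castSucc]
  ring

/-- The Taylor expansion in `x` of the `t`-th summand. -/
theorem hasSum_pivotChain {p : ℕ} {q : ℂ} (hq0 : q ≠ 0) (hq1 : ‖q‖ < 1) (x : Fin (p + 1) → ℂ)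
    {t : ℕ} (ht : t ≤ p) :
    HasSum (fun c : Fin (p + 1) → ℕ =>
        if c (Fin.last p) = 0 then 0 else -(chainWeight q x c * pivotChain q c t))
      (q ^ (p + 1 - t) * (∏ k : Fin (p + 1), if t ≤ (k : ℕ) then x k else 1) *
        ∑' c, KtermM p 0 q (scaledArgs q x t) c) := by
  refine ((raiseFrom_injective t).hasSum_iff fun c hc => ?_).mp ?_
  · by_contra hne
    refine hc (mem_range_raiseFrom fun k hk h0 => hne ?_)
    induction k using Fin.lastCases with
    | last => exact if_pos h0
    | cast k => simp [pivotChain_eq_zero q (k := k) hk h0]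
  · refine Eq.subst (motive := fun f => HasSum f _) (funext fun c => ?_)
      ((summable_KtermM_zero p hq1 (scaledArgs q x t)).hasSum.mul_left _)
    symm
    rw [Function.comp_apply, if_neg (by simp [raiseFrom, ht]),
      chainWeight_raiseFrom_mul_pivotChain hq0 x ht]

theorem sum_scaledArgs {p : ℕ} {q : ℂ} (hq0 : q ≠ 0) (hq1 : ‖q‖ < 1) (x : Fin (p + 1) → ℂ) :
    ∑ t ∈ Finset.range (p + 2),
      q ^ (p + 1 - t) * (∏ k : Fin (p + 1), if t ≤ (k : ℕ) then x k else 1) *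
        ∑' c, KtermM p 0 q (scaledArgs q x t) c = 1 := by
  have htop : (∏ k : Fin (p + 1), if p + 1 ≤ (k : ℕ) then x k else 1) = 1 :=
    Finset.prod_eq_one fun k _ => if_neg (by omega)
  rw [Finset.sum_range_succ, htop, Nat.sub_self, pow_zero, one_mul, one_mul]
  have hsum := (hasSum_sum (s := Finset.range (p + 1)) fun t ht =>
    hasSum_pivotChain hq0 hq1 x (Nat.le_of_lt_succ (Finset.mem_range.mp ht))).add
      (summable_KtermM_zero p hq1 (scaledArgs q x (p + 1))).hasSum
  refine hsum.unique ?_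
  convert hasSum_ite_eq (0 : Fin (p + 1) → ℕ) (1 : ℂ) using 2 with c
  rw [KtermM_scaledArgs_top hq0]
  by_cases hlast : c (Fin.last p) = 0
  · simp only [hlast, if_true, Finset.sum_const_zero, zero_add]
    split_ifs with hc
    · subst hc
      simp [chainWeight, qBinom]
    · rw [prod_qBinom_eq_zero q hlast hc, mul_zero]
  · have hc : c ≠ 0 := fun h => hlast (congrFun h _)
    simp only [hlast, hc, if_false]
    rw [Finset.sum_neg_distrib, ← Finset.mul_sum, sum_pivotChain_eq_prod_qBinom q hlast,
      neg_add_cancel]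

/-- for `m ≥ 2` (`m = p+2`), `0 < |q| < 1` and arbitrary `x_1,…,x_{m−1}`,
`Σ_{j=0}^{m−2} q^j (x_{m−j}⋯x_{m−1})
   K_m^{(0)}(q⁻¹x_1,…,q⁻¹x_{m−2−j}, x_{m−1−j}, q x_{m−j},…,q x_{m−1})
 = 1 − q^{m−1} x_1⋯x_{m−1} K_m^{(0)}(q x_1,…,q x_{m−1})`;
the `j`-th argument vector has its first `m−2−j` entries multiplied by `q⁻¹`, its
`(m−1−j)`-th entry unchanged, and its last `j` entries multiplied by `q` (positions
`i = k+1` for `k : Fin (p+1)`), and the `j = 0` coefficient product is empty (`= 1`). -/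
theorem stmt7 (m p : ℕ) (hm : m = p + 2) (q : ℂ) (hq0 : q ≠ 0) (hq1 : ‖q‖ < 1)
    (x : Fin (p + 1) → ℂ) :
    (∑ j ∈ Finset.range (p + 1),
        q ^ j * (∏ k : Fin (p + 1), if p + 1 - j ≤ (k : ℕ) then x k else 1) *
          ∑' c : Fin (p + 1) → ℕ,
            KtermM p 0 q
              (fun k =>
                if (k : ℕ) + 1 ≤ p - j then q⁻¹ * x k
                else if (k : ℕ) + 1 = p + 1 - j then x k
                else q * x k) c) =
      1 - q ^ (m - 1) * (∏ k : Fin (p + 1), x k) *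
        ∑' c : Fin (p + 1) → ℕ, KtermM p 0 q (fun k => q * x k) c := by
  subst hm
  have hsum := sum_scaledArgs hq0 hq1 x
  rw [← Finset.sum_range_reflect, Finset.sum_range_succ] at hsum
  refine eq_sub_of_add_eq (Eq.trans (congrArg₂ (· + ·) (Finset.sum_congr rfl fun j hj => ?_) ?_) hsum)
  · have hj' : j ≤ p := Nat.le_of_lt_succ (Finset.mem_range.mp hj)
    have hargs : scaledArgs q x (p + 1 - j) = fun k : Fin (p + 1) =>
        if (k : ℕ) + 1 ≤ p - j then q⁻¹ * x k
        else if (k : ℕ) + 1 = p + 1 - j then x k else q * x k := by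
      funext k
      simp only [scaledArgs, show (k : ℕ) + 2 ≤ p + 1 - j ↔ (k : ℕ) + 1 ≤ p - j by omega]
    rw [show p + 2 - 1 - j = p + 1 - j by omega, hargs, show p + 1 - (p + 1 - j) = j by omega]
  · have hargs : scaledArgs q x 0 = fun k : Fin (p + 1) => q * x k := by
      funext k
      simp [scaledArgs]
    rw [show p + 2 - 1 - (p + 1) = 0 by omega, hargs]
    simp
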